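/- In the ring O_L one has u₀² ≡ 1 (mod 4·O_L), and for every integer k (positive, zero, or negative) one has u₀^k ≢ -1 (mod 4·O_L); that is, 4 never divides u₀^k + 1 in O_L. -/

import Mathlib

open IntermediateField Polynomial

/-- The real fourth root of `2`. -/
noncomputable def alpha : ℝ := (2 : ℝ) ^ ((1 : ℝ) / 4)

/-- The number field `L = ℚ(2^{1/4})`, as a subfield of `ℝ`. -/
noncomputable def L : IntermediateField ℚ ℝ := ℚ⟮alpha⟯

noncomputable def alphaL : L := ⟨alpha, IntermediateField.mem_adjoin_simple_self ℚ alpha⟩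

/-- The unit `u₀ = (3 + 2√2) + (2 + 2√2)·α` of `O_L`. -/
noncomputable def u0 : L := (3 + 2 * alphaL ^ 2) + (2 + 2 * alphaL ^ 2) * alphaL

lemma alphaL_pow : alphaL ^ 4 = 2 := by
  apply Subtype.ext
  show alpha ^ 4 = 2
  unfold alpha
  rw [← Real.rpow_natCast, ← Real.rpow_mul (by norm_num)]
  norm_num

lemma two_int : IsIntegral ℤ (2 : L) := by
  simpa using (isIntegral_algebraMap (R := ℤ) (A := L) (x := 2))

lemma seven_int : IsIntegral ℤ (7 : L) := by
  simpa using (isIntegral_algebraMap (R := ℤ) (A := L) (x := 7))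

lemma three_int : IsIntegral ℤ (3 : L) := by
  simpa using (isIntegral_algebraMap (R := ℤ) (A := L) (x := 3))

lemma alphaL_int : IsIntegral ℤ alphaL := by
  apply IsIntegral.of_pow (n := 4) (by norm_num)
  rw [alphaL_pow]
  exact two_int

lemma rat_int (q : ℚ) (h : IsIntegral ℤ (algebraMap ℚ L q)) : ∃ n : ℤ, (n : ℚ) = q := by
  rw [isIntegral_algebraMap_iff (algebraMap ℚ L).injective] at h
  obtain ⟨n, hn⟩ := IsIntegrallyClosed.isIntegral_iff.mp h
  exact ⟨n, by simpa using hn⟩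

lemma w_int : IsIntegral ℤ (alphaL + alphaL ^ 2 + alphaL ^ 3) :=
  (alphaL_int.add (alphaL_int.pow 2)).add (alphaL_int.pow 3)

lemma u0_eq : u0 = 3 + 2 * (alphaL + alphaL ^ 2 + alphaL ^ 3) := by
  unfold u0; ring

lemma u0_int : IsIntegral ℤ u0 := by
  rw [u0_eq]
  exact three_int.add (two_int.mul w_int)

lemma u0_ne : u0 ≠ 0 := by
  have h : u0 * ((3 + 2 * alphaL ^ 2) - (2 + 2 * alphaL ^ 2) * alphaL) = 1 := by
    unfold u0
    linear_combination (-4 - 4 * alphaL ^ 2) * alphaL_pow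
  intro h0
  rw [h0, zero_mul] at h
  exact zero_ne_one h

lemma u0_sq : ∃ y : L, IsIntegral ℤ y ∧ u0 ^ 2 - 1 = 4 * y := by
  refine ⟨2 + 3 * (alphaL + alphaL ^ 2 + alphaL ^ 3) + (alphaL + alphaL ^ 2 + alphaL ^ 3) ^ 2,
    (two_int.add (three_int.mul w_int)).add (w_int.pow 2), ?_⟩
  rw [u0_eq]; ring

lemma u0_even (m : ℕ) : ∃ y : L, IsIntegral ℤ y ∧ u0 ^ (2 * m) = 1 + 4 * y := by
  obtain ⟨z, hz, hz'⟩ := u0_sq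
  induction m with
  | zero => exact ⟨0, isIntegral_zero, by simp⟩
  | succ m ih =>
    obtain ⟨y, hy, hy'⟩ := ih
    refine ⟨z + y * u0 ^ 2, hz.add (hy.mul (u0_int.pow 2)), ?_⟩
    rw [show 2 * (m + 1) = 2 * m + 2 by ring, pow_add, hy']
    linear_combination hz'

lemma u0_nat (k : ℕ) (y : L) (hy : IsIntegral ℤ y) (h : u0 ^ k + 1 = 4 * y) : False := by
  obtain ⟨m, hm | hm⟩ := Nat.even_or_odd' k
  · obtain ⟨z, hz, hz'⟩ := u0_even m
    rw [hm, hz'] at h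
    have h2 : algebraMap ℚ L (1 / 2) = y - z := by
      rw [map_div₀, map_one, map_ofNat]
      linear_combination h / 4
    obtain ⟨n, hn⟩ := rat_int (1 / 2) (h2 ▸ hy.sub hz)
    have : (2 * n : ℚ) = 1 := by rw [hn]; norm_num
    have : 2 * n = 1 := by exact_mod_cast this
    omega
  · obtain ⟨z, hz, hz'⟩ := u0_even m
    rw [hm, pow_succ, hz'] at h
    have h1 : IsIntegral ℤ (y - z * u0 - 1) := (hy.sub (hz.mul u0_int)).sub isIntegral_one
    have h2 : alphaL + alphaL ^ 2 + alphaL ^ 3 = 2 * (y - z * u0 - 1) := by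
      have := u0_eq
      linear_combination h / 2 - this / 2
    set t := y - z * u0 - 1 with ht
    have hv : IsIntegral ℤ ((1 + alphaL ^ 2 - alphaL) * (3 - alphaL ^ 2)) :=
      ((isIntegral_one.add (alphaL_int.pow 2)).sub alphaL_int).mul
        (three_int.sub (alphaL_int.pow 2))
    have h3 : 7 * alphaL = 2 * (t * ((1 + alphaL ^ 2 - alphaL) * (3 - alphaL ^ 2))) := by
      linear_combination ((1 + alphaL ^ 2 - alphaL) * (3 - alphaL ^ 2)) * h2 +
        (alphaL ^ 3 - 2 * alphaL) * alphaL_pow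
    have h4 := (h1.mul hv).pow 4
    set r := t * ((1 + alphaL ^ 2 - alphaL) * (3 - alphaL ^ 2))
    have h5 : algebraMap ℚ L (2401 / 8) = r ^ 4 := by
      have e : (7 * alphaL) ^ 4 = (2 * r) ^ 4 := by rw [h3]
      rw [map_div₀, map_ofNat, map_ofNat]
      linear_combination e / 16 - 2401 / 16 * alphaL_pow
    obtain ⟨n, hn⟩ := rat_int _ (h5 ▸ h4)
    have : (8 * n : ℚ) = 2401 := by rw [hn]; norm_num
    have : 8 * n = 2401 := by exact_mod_cast this
    omega

/-- `u₀² ≡ 1 (mod 4·O_L)`, and for every integer `k` one has `u₀^k ≢ -1 (mod 4·O_L)`: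
`4` never divides `u₀^k + 1` in the ring of integers `O_L`. -/
theorem stmt12 :
    (∃ y : L, IsIntegral ℤ y ∧ u0 ^ 2 - 1 = 4 * y) ∧
    (∀ k : ℤ, ¬ ∃ y : L, IsIntegral ℤ y ∧ u0 ^ k + 1 = 4 * y) := by
  refine ⟨u0_sq, ?_⟩
  rintro k ⟨y, hy, h⟩
  obtain ⟨n, rfl | rfl⟩ := k.eq_nat_or_neg
  · exact u0_nat n y hy (by simpa using h)
  · refine u0_nat n (y * u0 ^ n) (hy.mul (u0_int.pow n)) ?_
    rw [zpow_neg, zpow_natCast] at h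
    have hn : (u0 ^ n)⁻¹ * u0 ^ n = 1 := inv_mul_cancel₀ (pow_ne_zero n u0_ne)
    linear_combination u0 ^ n * h - hn
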